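/- Let r > 0 be a real number. Define u : (0,∞) × ℝ → ℝ by u(t,x) = (r / (2π·sinh(2rt)))^{1/2} · exp(−(r/2)·coth(2rt)·x²). Then for every t > 0 and every x ∈ ℝ, the partial derivative ∂_t u(t,x) exists and equals ∂²_x u(t,x) − r²·x²·u(t,x); that is, u solves the heat equation (∂_t − ∂²_x + r² x²) u = 0 for the one-dimensional harmonic oscillator H = −∂²_x + r² x². -/

import Mathlib

open Real

/-- The real hyperbolic cotangent. -/
noncomputable def Real.coth' (x : ℝ) : ℝ := Real.cosh x / Real.sinh x

theorem Real.hasDerivAt_coth' {x : ℝ} (hx : x ≠ 0) :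
    HasDerivAt Real.coth' (-1 / Real.sinh x ^ 2) x := by
  have hs : Real.sinh x ≠ 0 := Real.sinh_eq_zero.not.mpr hx
  refine ((Real.hasDerivAt_cosh x).div (Real.hasDerivAt_sinh x) hs).congr_deriv ?_
  congr 1
  linear_combination -Real.cosh_sq x

/-- The amplitude `√(c / sinh t)` has logarithmic derivative `-coth t / 2`. -/
theorem hasDerivAt_sqrt_div_sinh {c t : ℝ} (hc : 0 < c) (ht : 0 < t) :
    HasDerivAt (fun s => √(c / Real.sinh s)) (-(Real.coth' t / 2) * √(c / Real.sinh t)) t := by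
  have hs : 0 < Real.sinh t := Real.sinh_pos_iff.mpr ht
  have hA : 0 < c / Real.sinh t := div_pos hc hs
  refine (((hasDerivAt_const t c).div (Real.hasDerivAt_sinh t) hs.ne').sqrt hA.ne').congr_deriv ?_
  have hS : √(c / Real.sinh t) ≠ 0 := (Real.sqrt_pos.mpr hA).ne'
  rw [Pi.div_apply, div_eq_iff (mul_ne_zero two_ne_zero hS)]
  have hsq : √(c / Real.sinh t) * √(c / Real.sinh t) = c / Real.sinh t := Real.mul_self_sqrt hA.le
  calc _ = -Real.coth' t * (c / Real.sinh t) := by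
        unfold Real.coth'
        field_simp
        ring
    _ = _ := by linear_combination Real.coth' t * hsq

theorem hasDerivAt_gaussian (a b x : ℝ) :
    HasDerivAt (fun y => a * Real.exp (b * y ^ 2)) (2 * b * x * (a * Real.exp (b * x ^ 2))) x := by
  refine ((((hasDerivAt_pow 2 x).const_mul b).exp).const_mul a).congr_deriv ?_
  push_cast
  ring

theorem deriv_deriv_gaussian (a b x : ℝ) :
    deriv (fun y => deriv (fun z => a * Real.exp (b * z ^ 2)) y) x =
      (2 * b + (2 * b * x) ^ 2) * (a * Real.exp (b * x ^ 2)) := by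
  simp_rw [fun y => (hasDerivAt_gaussian a b y).deriv]
  have h := ((hasDerivAt_id x).const_mul (2 * b)).mul (hasDerivAt_gaussian a b x)
  refine h.deriv.trans ?_
  simp only [id]
  ring

/-- Mehler's formula: `u(t,x) = (r/(2π sinh(2rt)))^{1/2} exp(−(r/2) coth(2rt) x²)` solves
the harmonic-oscillator heat equation `∂ₜ u = ∂ₓ² u − r² x² u` on `(0,∞) × ℝ`. -/
theorem mehler_heat_equation (r : ℝ) (hr : 0 < r) (u : ℝ → ℝ → ℝ)
    (hu : ∀ t x : ℝ, u t x =
      Real.sqrt (r / (2 * π * Real.sinh (2 * r * t))) *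
        Real.exp (-(r / 2) * Real.coth' (2 * r * t) * x ^ 2)) :
    ∀ t : ℝ, 0 < t → ∀ x : ℝ,
      HasDerivAt (fun s : ℝ => u s x)
        (deriv (fun y : ℝ => deriv (fun z : ℝ => u t z) y) x - r ^ 2 * x ^ 2 * u t x) t := by
  intro t ht x
  have hT : 0 < 2 * r * t := by positivity
  have hs : Real.sinh (2 * r * t) ≠ 0 := (Real.sinh_pos_iff.mpr hT).ne'
  simp_rw [hu, deriv_deriv_gaussian, ← div_div r (2 * π)]
  have hlin : HasDerivAt (fun s => 2 * r * s) (2 * r) t := by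
    simpa using (hasDerivAt_id t).const_mul (2 * r)
  have hamp := (hasDerivAt_sqrt_div_sinh (c := r / (2 * π)) (by positivity) hT).comp t hlin
  have hexp := ((((Real.hasDerivAt_coth' hT.ne').comp t hlin).const_mul (-(r / 2))).mul_const
    (x ^ 2)).exp
  refine (hamp.mul hexp).congr_deriv ?_
  have hcoth : Real.coth' (2 * r * t) ^ 2 = 1 + 1 / Real.sinh (2 * r * t) ^ 2 := by
    unfold Real.coth'
    rw [div_pow, Real.cosh_sq]
    field_simp
  simp only [Function.comp_apply]
  linear_combination (-(r ^ 2 * x ^ 2) * √(r / (2 * π) / Real.sinh (2 * r * t)) *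
    Real.exp (-(r / 2) * Real.coth' (2 * r * t) * x ^ 2)) * hcoth
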